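/- Let G be a graph consisting of a Hamiltonian cycle on n vertices together with r - 1 chords, so that G has cyclomatic number r. Then the number of cycles of G is at most 2^r - 1. -/

import Mathlib

theorem aux_path {V : Type*} [Fintype V] [DecidableEq V] (G : SimpleGraph V) (f : Sym2 V → ZMod 2)
    (hf : ∀ x, ∑ e : Sym2 V, (if x ∈ e then f e else 0) = 0) {u v : V} (p : G.Walk u v)
    (hp : p.IsPath) (hs : ∀ e, e ∉ p.edges → f e = 0) : ∀ e, f e = 0 := by
  induction p with
  | nil => intro e; exact hs e (by simp)
  | @cons u v w h p ih =>
    rw [SimpleGraph.Walk.cons_isPath_iff] at hp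
    apply ih hp.1
    intro e he
    by_cases h1 : e = s(u, v)
    · have h2 := hf u
      rw [Finset.sum_eq_single s(u, v)] at h2
      · simpa [h1] using h2
      · intro b _ hb
        split_ifs with hub
        · apply hs
          rw [SimpleGraph.Walk.edges_cons, List.mem_cons, not_or]
          refine ⟨hb, fun hbp => hp.2 ?_⟩
          exact SimpleGraph.Walk.mem_support_of_mem_edges hbp hub
        · rfl
      · simp
    · apply hs
      simp [h1, he]

theorem aux_even {V : Type*} [Fintype V] [DecidableEq V] (G : SimpleGraph V) {u : V}
    (w : G.Walk u u) (hw : w.IsCycle) (x : V) :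
    ∑ e : Sym2 V, (if x ∈ e then (if e ∈ w.edges then (1 : ZMod 2) else 0) else 0) = 0 := by
  have h1 : Even (w.edges.countP (fun e => x ∈ e)) := by
    rw [hw.isTrail.even_countP_edges_iff]; simp
  have h2 : w.edges.countP (fun e => x ∈ e)
      = (Finset.univ.filter (fun e : Sym2 V => x ∈ e ∧ e ∈ w.edges)).card := by
    rw [List.countP_eq_length_filter,
      ← List.toFinset_card_of_nodup (hw.isTrail.edges_nodup.filter _)]
    congr 1
    ext e
    simp [and_comm]
  rw [h2] at h1
  simp_rw [← ite_and]
  rw [Finset.sum_boole]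
  exact (ZMod.natCast_eq_zero_iff_even).2 h1

/-- A graph consisting of a Hamiltonian cycle together with `r - 1` chords
(hence with cyclomatic number `r`) has at most `2^r - 1` cycles. -/
theorem stmt_12 {V : Type*} [Fintype V] [DecidableEq V] (G : SimpleGraph V) (v : V)
    (H : G.Walk v v) (hH : H.IsHamiltonianCycle)
    (r : ℕ) (hr : 1 ≤ r)
    (hchords : (G.edgeSet \ {e | e ∈ H.edges}).ncard = r - 1) :
    {C : Set (Sym2 V) |
        ∃ (u : V) (w : G.Walk u u), w.IsCycle ∧ {e | e ∈ w.edges} = C}.ncard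
      ≤ 2 ^ r - 1 := by
  have hc := hH.isCycle
  clear hH
  cases H with
  | nil => exact absurd hc (by simp)
  | @cons _ b _ h p =>
  rw [SimpleGraph.Walk.cons_isCycle_iff] at hc
  obtain ⟨hp, -⟩ := hc
  set T : Set (Sym2 V) := insert s(v, b) (G.edgeSet \ {e | e ∈ (SimpleGraph.Walk.cons h p).edges})
    with hT
  have hTc : T.ncard ≤ r := by
    have := Set.ncard_insert_le s(v, b)
      (G.edgeSet \ {e | e ∈ (SimpleGraph.Walk.cons h p).edges})
    rw [hchords, Nat.sub_add_cancel hr] at this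
    exact this
  have key : ∀ f : Sym2 V → ZMod 2, (∀ x, ∑ e : Sym2 V, (if x ∈ e then f e else 0) = 0) →
      (∀ e, e ∉ G.edgeSet → f e = 0) → (∀ e ∈ T, f e = 0) → ∀ e, f e = 0 := by
    intro f h1 h2 h3
    refine aux_path G f h1 p hp fun e he => ?_
    by_cases hG : e ∈ G.edgeSet
    · apply h3
      by_cases hb : e = s(v, b)
      · exact Or.inl hb
      · exact Or.inr ⟨hG, by simp [hb, he]⟩
    · exact h2 e hG
  have hpow : (T.powerset \ {∅}).ncard ≤ 2 ^ r - 1 := by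
    rw [Set.ncard_sdiff (by simp), Set.ncard_powerset T, Set.ncard_singleton]
    exact Nat.sub_le_sub_right (Nat.pow_le_pow_right (by norm_num) hTc) 1
  refine le_trans (Set.ncard_le_ncard_of_injOn (fun C => C ∩ T) ?_ ?_ (Set.toFinite _)) hpow
  · rintro C ⟨u, w, hw, rfl⟩
    refine ⟨Set.inter_subset_right, fun h0 => ?_⟩
    have h0 : {e | e ∈ w.edges} ∩ T = ∅ := h0
    have := key (fun e => if e ∈ w.edges then 1 else 0) (aux_even G w hw)
      (fun e he => if_neg fun h' => he (w.edges_subset_edgeSet h'))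
      (fun e he => if_neg fun h' => by
        have : e ∈ {e | e ∈ w.edges} ∩ T := ⟨h', he⟩
        simp [h0] at this)
    cases w with
    | nil => simp at hw
    | @cons _ c _ h' q => simpa using this s(u, c)
  · rintro C ⟨u, w, hw, rfl⟩ C' ⟨u', w', hw', rfl⟩ heq
    have heq : {e | e ∈ w.edges} ∩ T = {e | e ∈ w'.edges} ∩ T := heq
    have := key (fun e => (if e ∈ w.edges then 1 else 0) - (if e ∈ w'.edges then 1 else 0))
      (fun x => by
        have h1 := aux_even G w hw x
        have h2 := aux_even G w' hw' x
        have h3 := sub_eq_zero.2 (h1.trans h2.symm)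
        rw [← Finset.sum_sub_distrib] at h3
        refine Eq.trans ?_ h3
        refine Finset.sum_congr rfl fun e _ => ?_
        split_ifs <;> simp)
      (fun e he => by
        rw [if_neg fun h' => he (w.edges_subset_edgeSet h'),
          if_neg fun h' => he (w'.edges_subset_edgeSet h'), sub_zero])
      (fun e he => by
        have h3 : e ∈ w.edges ↔ e ∈ w'.edges := by
          have := Set.ext_iff.1 heq e
          simpa [he] using this
        simp [h3])
    ext e
    have h4 := this e
    by_cases ha : e ∈ w.edges <;> by_cases hb : e ∈ w'.edges <;> simp [ha, hb] at h4 ⊢
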